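/- arXiv:2204.02914 — 2 statements merged into one kernel-verified Lean document; each statement's English description precedes it below -/
import Mathlib

section
/- Let s ∈ ℂ with Re s > 1/2, let c ∈ ℂ, and let ψ : ℍ → ℂ be a continuous function invariant under the Möbius action of SL₂(ℤ) (so in particular ψ(z+1) = ψ(z)). Assume that z ↦ ψ(z) − ∫₀¹ ψ(u + i·Im z) du is bounded on {z ∈ ℍ : Im z ≥ 1/2}, and that ∫₀¹ ψ(u+iy) du = c · y^(1/2−s) for all y > 0. Then c = 0; consequently ψ is bounded on ℍ and its constant term vanishes identically. -/
open scoped UpperHalfPlane MatrixGroups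
open Complex

/-- The point `x + iy` of the upper half-plane, for `y > 0`. -/
def pt (x y : ℝ) (hy : 0 < y) : ℍ := ⟨⟨x, y⟩, hy⟩

/-- An `SL₂(ℤ)`-invariant function that is bounded on `{Im z ≥ 1/2}` is bounded on `ℍ`. -/
theorem norm_le_of_invariant_of_norm_le {E : Type*} [Norm E] {ψ : ℍ → E}
    (hinv : ∀ γ : SL(2, ℤ), ∀ z : ℍ, ψ (γ • z) = ψ z) {B : ℝ}
    (hB : ∀ z : ℍ, 1 / 2 ≤ z.im → ‖ψ z‖ ≤ B) (z : ℍ) : ‖ψ z‖ ≤ B := by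
  obtain ⟨γ, hγ⟩ := ModularGroup.exists_one_half_le_im_smul z
  rw [← hinv γ z]
  exact hB _ hγ

/-- If `c * y ^ a` is bounded for `y > 0` and `Re a < 0`, then `c = 0`. -/
theorem eq_zero_of_norm_mul_cpow_le {a c : ℂ} (ha : a.re < 0) {B : ℝ}
    (hB : ∀ y : ℝ, 0 < y → ‖c * (y : ℂ) ^ a‖ ≤ B) : c = 0 := by
  by_contra hc
  have hlim := (tendsto_rpow_neg_nhdsGT_zero ha).const_mul_atTop (norm_pos_iff.mpr hc)
  obtain ⟨y, hy, hy0⟩ :=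
    ((hlim.eventually_gt_atTop B).and self_mem_nhdsWithin).exists
  have h := hB y hy0
  rw [norm_mul, norm_cpow_eq_rpow_re_of_pos hy0] at h
  exact absurd h (not_le.mpr hy)

/-- Let `Re s > 1/2` and let `ψ : ℍ → ℂ` be continuous and `SL₂(ℤ)`-invariant. If
`ψ` minus its constant term is bounded on `{Im z ≥ 1/2}` and the constant term equals
`c·y^(1/2−s)` for all `y > 0`, then `c = 0`; consequently `ψ` is bounded and its
constant term vanishes identically. -/
theorem uniqueness_input (s : ℂ) (hs : 1 / 2 < s.re) (c : ℂ) (ψ : ℍ → ℂ)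
    (hcont : Continuous ψ)
    (hinv : ∀ γ : SL(2, ℤ), ∀ z : ℍ, ψ (γ • z) = ψ z)
    (hbnd : ∃ B : ℝ, ∀ z : ℍ, 1 / 2 ≤ z.im →
      ‖ψ z - ∫ u in (0:ℝ)..1, ψ (pt u z.im z.im_pos)‖ ≤ B)
    (hct : ∀ y : ℝ, ∀ hy : 0 < y,
      ∫ u in (0:ℝ)..1, ψ (pt u y hy) = c * (y : ℂ) ^ ((1:ℂ) / 2 - s)) :
    c = 0 ∧ (∃ B : ℝ, ∀ z : ℍ, ‖ψ z‖ ≤ B) ∧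
      ∀ y : ℝ, ∀ hy : 0 < y, ∫ u in (0:ℝ)..1, ψ (pt u y hy) = 0 := by
  have ha : ((1 : ℂ) / 2 - s).re < 0 := by
    have : ((1 : ℂ) / 2 - s).re = 1 / 2 - s.re := by norm_num
    linarith
  obtain ⟨B, hB⟩ := hbnd
  obtain ⟨M, hM⟩ : ∃ M : ℝ, ∀ z : ℍ, ‖ψ z‖ ≤ M := by
    refine ⟨B + ‖c‖ * (1 / 2 : ℝ) ^ ((1 : ℂ) / 2 - s).re, ?_⟩
    refine norm_le_of_invariant_of_norm_le hinv fun z hz ↦ ?_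
    have h := hB z hz
    rw [hct z.im z.im_pos] at h
    refine (norm_le_norm_sub_add _ _).trans (add_le_add h ?_)
    rw [norm_mul, norm_cpow_eq_rpow_re_of_pos z.im_pos]
    exact mul_le_mul_of_nonneg_left
      (Real.rpow_le_rpow_of_nonpos (by norm_num) hz ha.le) (norm_nonneg c)
  have hc : c = 0 := by
    refine eq_zero_of_norm_mul_cpow_le (B := M) ha fun y hy ↦ ?_
    rw [← hct y hy]
    exact (intervalIntegral.norm_integral_le_of_norm_le_const
      fun u _ ↦ hM (pt u y hy)).trans_eq (by rw [sub_zero, abs_one, mul_one])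
  exact ⟨hc, ⟨M, hM⟩, fun y hy ↦ by rw [hct y hy, hc, zero_mul]⟩
end

section
/- Let U ⊆ ℂ be open and connected, let M : U → Matrix(m, n, ℂ) and b : U → ℂ^m have all entries holomorphic on U, and suppose that the set U_unq of points s ∈ U at which the linear system M(s)·x = b(s) has a unique solution x ∈ ℂⁿ has nonempty interior. Then there exist a closed discrete subset D ⊂ U and a holomorphic function v : U ∖ D → ℂⁿ such that for every s ∈ U ∖ D, v(s) is the unique solution of M(s)·x = b(s), and each coordinate function s ↦ vⱼ(s) extends to a meromorphic function on U. -/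
open Complex Matrix

theorem Matrix.mulVec_injective_of_existsUnique {m n : Type*} [Fintype n]
    {A : Matrix m n ℂ} {b : m → ℂ} (h : ∃! x : n → ℂ, A *ᵥ x = b) :
    Function.Injective A.mulVec := by
  obtain ⟨x, hx, huniq⟩ := h
  intro y z hyz
  have hyz' : A *ᵥ y = A *ᵥ z := hyz
  have h1 : x + (y - z) = x := huniq _ (by simp [mulVec_add, mulVec_sub, hx, hyz'])
  exact sub_eq_zero.1 (by simpa using h1)

theorem Matrix.exists_mul_eq_one_of_mulVec_injective {m n : Type*} [Fintype m] [Fintype n]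
    [DecidableEq m] [DecidableEq n] {A : Matrix m n ℂ} (h : Function.Injective A.mulVec) :
    ∃ L : Matrix n m ℂ, L * A = 1 := by
  obtain ⟨g, hg⟩ := (Matrix.toLin' A).exists_leftInverse_of_injective
    (LinearMap.ker_eq_bot.2 h)
  refine ⟨LinearMap.toMatrix' g, ?_⟩
  have h1 := congrArg LinearMap.toMatrix' hg
  simpa [LinearMap.toMatrix'_comp] using h1

theorem DifferentiableOn.matrix_mul_apply {l m n : Type*} [Fintype m] {U : Set ℂ}
    {A : ℂ → Matrix l m ℂ} {B : ℂ → Matrix m n ℂ}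
    (hA : ∀ i j, DifferentiableOn ℂ (fun s => A s i j) U)
    (hB : ∀ i j, DifferentiableOn ℂ (fun s => B s i j) U) (i : l) (j : n) :
    DifferentiableOn ℂ (fun s => (A s * B s) i j) U := by
  simp only [Matrix.mul_apply]
  exact DifferentiableOn.fun_sum fun k _ => (hA i k).mul (hB k j)

theorem DifferentiableOn.matrix_mulVec_apply {m n : Type*} [Fintype n] {U : Set ℂ}
    {A : ℂ → Matrix m n ℂ} {x : ℂ → n → ℂ}
    (hA : ∀ i j, DifferentiableOn ℂ (fun s => A s i j) U)
    (hx : ∀ j, DifferentiableOn ℂ (fun s => x s j) U) (i : m) :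
    DifferentiableOn ℂ (fun s => (A s *ᵥ x s) i) U := by
  simp only [Matrix.mulVec, dotProduct]
  exact DifferentiableOn.fun_sum fun k _ => (hA i k).mul (hx k)

theorem DifferentiableOn.matrix_det {n : Type*} [Fintype n] [DecidableEq n] {U : Set ℂ}
    {A : ℂ → Matrix n n ℂ} (hA : ∀ i j, DifferentiableOn ℂ (fun s => A s i j) U) :
    DifferentiableOn ℂ (fun s => (A s).det) U := by
  simp only [Matrix.det_apply']
  exact DifferentiableOn.fun_sum fun σ _ =>
    (DifferentiableOn.fun_finsetProd fun k _ => hA (σ k) k).const_mul _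

theorem DifferentiableOn.matrix_adjugate_apply {n : Type*} [Fintype n] [DecidableEq n]
    {U : Set ℂ} {A : ℂ → Matrix n n ℂ}
    (hA : ∀ i j, DifferentiableOn ℂ (fun s => A s i j) U) (i j : n) :
    DifferentiableOn ℂ (fun s => (A s).adjugate i j) U := by
  simp only [Matrix.adjugate_apply]
  refine DifferentiableOn.matrix_det fun k l => ?_
  simp only [Matrix.updateRow_apply]
  split_ifs
  · exact differentiableOn_const _
  · exact hA k l

theorem AnalyticOnNhd.eventually_nhdsNE_ne_zero {f : ℂ → ℂ} {U : Set ℂ}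
    (hf : AnalyticOnNhd ℂ f U) (hU : IsPreconnected U) {z w : ℂ} (hz : z ∈ U) (hfz : f z ≠ 0)
    (hw : w ∈ U) : ∀ᶠ s in nhdsWithin w {w}ᶜ, f s ≠ 0 :=
  (hf w hw).eventually_eq_zero_or_eventually_ne_zero.resolve_left fun h =>
    hfz (hf.eqOn_zero_of_preconnected_of_eventuallyEq_zero hU hw h hz)

/-- Cramer's rule for an overdetermined system `A x = b` with a chosen square reduction `L A`. -/
theorem Matrix.det_smul_eq_adjugate_mulVec {m n : Type*} [Fintype m] [Fintype n] [DecidableEq n]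
    {A : Matrix m n ℂ} {b : m → ℂ} {x : n → ℂ} (L : Matrix n m ℂ) (h : A *ᵥ x = b) :
    (L * A).det • x = (L * A).adjugate *ᵥ (L *ᵥ b) := by
  rw [← h, mulVec_mulVec, mulVec_mulVec, Matrix.mul_assoc,
    adjugate_mul, smul_mulVec, one_mulVec]

/-- Principle of meromorphic continuation for holomorphic systems of linear equations,
finite-dimensional case: if the entries of `M` and `b` are holomorphic on an open
connected `U ⊆ ℂ` and the set of points where `M(s)x = b(s)` has a unique solution has
nonempty interior, then there is a closed discrete `D ⊆ U` and a holomorphic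
`v : U ∖ D → ℂⁿ` giving the unique solution, each coordinate of which extends
meromorphically to `U`. -/
theorem principle_of_meromorphic_continuation (m n : ℕ) (U : Set ℂ)
    (hUopen : IsOpen U) (hUconn : IsConnected U)
    (M : ℂ → Matrix (Fin m) (Fin n) ℂ) (b : ℂ → Fin m → ℂ)
    (hM : ∀ i j, DifferentiableOn ℂ (fun s => M s i j) U)
    (hb : ∀ i, DifferentiableOn ℂ (fun s => b s i) U)
    (hunq : (interior {s ∈ U | ∃! x : Fin n → ℂ, M s *ᵥ x = b s}).Nonempty) :
    ∃ (D : Set ℂ) (v : ℂ → Fin n → ℂ),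
      D ⊆ U ∧
      (∀ x ∈ D, ∃ V ∈ nhds x, V ∩ D ⊆ {x}) ∧
      (U ∩ closure D ⊆ D) ∧
      (∀ j, DifferentiableOn ℂ (fun s => v s j) (U \ D)) ∧
      (∀ s ∈ U \ D, M s *ᵥ v s = b s ∧ ∀ x : Fin n → ℂ, M s *ᵥ x = b s → x = v s) ∧
      (∀ j, ∃ g : ℂ → ℂ, MeromorphicOn g U ∧ ∀ s ∈ U \ D, g s = v s j) := by
  obtain ⟨s₀, hs₀⟩ := hunq
  obtain ⟨hs₀U, hs₀uniq⟩ := interior_subset hs₀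
  obtain ⟨L, hL⟩ := exists_mul_eq_one_of_mulVec_injective
    (mulVec_injective_of_existsUnique hs₀uniq)
  have hA := DifferentiableOn.matrix_mul_apply (A := fun _ => L)
    (fun _ _ => differentiableOn_const _) hM
  set d : ℂ → ℂ := fun s => (L * M s).det with hd
  set w : ℂ → Fin n → ℂ := fun s => (L * M s).adjugate *ᵥ (L *ᵥ b s) with hw
  have hd_diff : DifferentiableOn ℂ d U := DifferentiableOn.matrix_det hA
  have hw_diff : ∀ j, DifferentiableOn ℂ (fun s => w s j) U :=
    DifferentiableOn.matrix_mulVec_apply (DifferentiableOn.matrix_adjugate_apply hA)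
      (DifferentiableOn.matrix_mulVec_apply (fun _ _ => differentiableOn_const _) hb)
  have hd_an : AnalyticOnNhd ℂ d U := hd_diff.analyticOnNhd hUopen
  have hds₀ : d s₀ ≠ 0 := by simp [hd, hL]
  have hd_ev : ∀ x ∈ U, ∀ᶠ s in nhdsWithin x {x}ᶜ, d s ≠ 0 := fun x hx =>
    hd_an.eventually_nhdsNE_ne_zero hUconn.isPreconnected hs₀U hds₀ hx
  have hMw : ∀ s ∈ U, M s *ᵥ w s = d s • b s := by
    intro s hs
    ext i
    refine AnalyticOnNhd.eqOn_of_preconnected_of_eventuallyEq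
      (f := fun s => (M s *ᵥ w s) i) (g := fun s => (d s • b s) i)
      ((DifferentiableOn.matrix_mulVec_apply hM hw_diff i).analyticOnNhd hUopen)
      ((hd_diff.mul (hb i)).analyticOnNhd hUopen) hUconn.isPreconnected hs₀U ?_ hs
    filter_upwards [mem_interior_iff_mem_nhds.1 hs₀] with t ht
    obtain ⟨x, hx, -⟩ := ht.2
    have hwx : w t = d t • x := (det_smul_eq_adjugate_mulVec L hx).symm
    simp only [hwx, mulVec_smul, hx]
  have hv_diff : ∀ j, DifferentiableOn ℂ (fun s => ((d s)⁻¹ • w s) j) (U \ {s ∈ U | d s = 0}) :=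
    fun j => ((hd_diff.mono Set.sdiff_subset).inv
      fun s (hs : s ∈ U ∧ s ∉ {s ∈ U | d s = 0}) h => hs.2 ⟨hs.1, h⟩).mul
      ((hw_diff j).mono Set.sdiff_subset)
  refine ⟨{s ∈ U | d s = 0}, fun s => (d s)⁻¹ • w s, Set.sep_subset _ _, ?_, ?_, hv_diff, ?_, ?_⟩
  · intro x hx
    refine ⟨_, eventually_nhdsWithin_iff.1 (hd_ev x hx.1), ?_⟩
    rintro y ⟨hy, -, hdy⟩
    by_contra hyx
    exact hy hyx hdy
  · rintro x ⟨hxU, hx⟩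
    refine ⟨hxU, ?_⟩
    by_contra hdx
    obtain ⟨y, hy, hyD⟩ := mem_closure_iff_nhds.1 hx _
      ((hd_an x hxU).continuousAt.eventually_ne hdx)
    exact hy hyD.2
  · intro s hs
    have hds : d s ≠ 0 := fun h => hs.2 ⟨hs.1, h⟩
    refine ⟨by rw [mulVec_smul, hMw s hs.1, inv_smul_smul₀ hds], fun x hx => ?_⟩
    exact (eq_inv_smul_iff₀ hds).2 (det_smul_eq_adjugate_mulVec L hx)
  · intro j
    exact ⟨fun s => ((d s)⁻¹ • w s) j, hd_an.meromorphicOn.inv.mul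
      ((hw_diff j).analyticOnNhd hUopen).meromorphicOn, fun _ _ => rfl⟩
end
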